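/- arXiv:math/0502462 — 4 statements merged into one kernel-verified Lean document; each statement's English description precedes it below -/
import Mathlib

section
/- For the action of ℂˣ on ℙ²(ℂ) given by λ·[x:y:z] = [λx : λ⁻¹y : z], and for any x₀, y₀, z₀ ∈ ℂ all nonzero, the topological closure of the orbit ℂˣ·[x₀:y₀:z₀] in ℙ²(ℂ) equals the full conic {[x:y:z] ∈ ℙ²(ℂ) : x·y·z₀² = x₀·y₀·z²}; equivalently, the closure is the orbit together with exactly the two points [1:0:0] and [0:1:0]. -/
noncomputable section

open Projectivization
open scoped LinearAlgebra.Projectivization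

/-- The quotient topology on complex projective spaces (quotient of `ℂⁿ ∖ {0}` by scalars). -/
instance (n : ℕ) : TopologicalSpace (ℙ ℂ (Fin n → ℂ)) :=
  inferInstanceAs (TopologicalSpace (Quotient (projectivizationSetoid ℂ (Fin n → ℂ))))

lemma ne_zero_of_coord {n : ℕ} {v : Fin n → ℂ} (i : Fin n) (h : v i ≠ 0) : v ≠ 0 :=
  fun H => h (by rw [H]; rfl)

/-- The complex projective plane `ℙ²(ℂ)`. -/
abbrev P2 := ℙ ℂ (Fin 3 → ℂ)

/-- The weights of the `ℂˣ`-action `λ·[x:y:z] = [λx : λ⁻¹y : z]`. -/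
def wt (lam : ℂˣ) : Fin 3 → ℂ := ![(lam : ℂ), ((lam⁻¹ : ℂˣ) : ℂ), 1]

lemma wt_ne (lam : ℂˣ) (i : Fin 3) : wt lam i ≠ 0 := by
  fin_cases i <;> simp [wt]

/-- The linear map `(x, y, z) ↦ (λx, λ⁻¹y, z)`. -/
def actMap (lam : ℂˣ) : (Fin 3 → ℂ) →ₗ[ℂ] (Fin 3 → ℂ) where
  toFun v := fun i => wt lam i * v i
  map_add' a b := by funext i; simp [mul_add]
  map_smul' c a := by funext i; simp [Pi.smul_apply, smul_eq_mul]; ring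

lemma actMap_inj (lam : ℂˣ) : Function.Injective (actMap lam) := by
  intro v w h
  funext i
  exact mul_left_cancel₀ (wt_ne lam i) (congrFun h i)

/-- The action `λ·[x:y:z] = [λx : λ⁻¹y : z]` of `ℂˣ` on `ℙ²(ℂ)`. -/
instance : SMul ℂˣ P2 := ⟨fun lam => Projectivization.map (actMap lam) (actMap_inj lam)⟩

lemma smul_mk (lam : ℂˣ) (v : Fin 3 → ℂ) (hv : v ≠ 0) :
    lam • Projectivization.mk ℂ v hv =
      Projectivization.mk ℂ (fun i => wt lam i * v i)
        (fun H => hv (actMap_inj lam (H.trans (map_zero (actMap lam)).symm))) := by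
  exact Projectivization.map_mk (actMap lam) (actMap_inj lam) v hv

lemma mk_eq_of_eq {v w : Fin 3 → ℂ} (hv : v ≠ 0) (h : v = w) :
    Projectivization.mk ℂ v hv = Projectivization.mk ℂ w (h ▸ hv) := by subst h; rfl

instance : MulAction ℂˣ P2 where
  one_smul p := by
    induction p using Projectivization.ind with
    | h v hv =>
      rw [smul_mk]
      refine (mk_eq_of_eq _ ?_).symm
      funext i; fin_cases i <;> simp [wt]
  mul_smul a b p := by
    induction p using Projectivization.ind with
    | h v hv =>
      rw [smul_mk, smul_mk, smul_mk]
      refine mk_eq_of_eq _ ?_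
      funext i; fin_cases i <;> simp [wt] <;> ring

lemma continuous_mk_aux (f : ℂ → Fin 3 → ℂ) (hf : Continuous f) (h0 : ∀ t, f t ≠ 0) :
    Continuous (fun t => (Projectivization.mk ℂ (f t) (h0 t) : P2)) := by
  have h1 : Continuous (fun t => (⟨f t, h0 t⟩ : {v : Fin 3 → ℂ // v ≠ 0})) :=
    hf.subtype_mk _
  exact (continuous_quotient_mk' (s := projectivizationSetoid ℂ (Fin 3 → ℂ))).comp h1

lemma mk_mem_conic_iff (a b : ℂ) (v : Fin 3 → ℂ) (hv : v ≠ 0) :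
    (Projectivization.mk ℂ v hv : P2) ∈ {p : P2 | ∃ (x y z : ℂ) (h : ![x, y, z] ≠ 0),
        p = Projectivization.mk ℂ ![x, y, z] h ∧ x * y * a = b * z ^ 2} ↔
      v 0 * v 1 * a = b * v 2 ^ 2 := by
  constructor
  · rintro ⟨x, y, z, h, he, hc⟩
    rw [Projectivization.mk_eq_mk_iff'] at he
    obtain ⟨c, rfl⟩ := he
    simp
    linear_combination c ^ 2 * hc
  · intro hc
    have e : v = ![v 0, v 1, v 2] := by
      funext i; fin_cases i <;> rfl
    exact ⟨v 0, v 1, v 2, e ▸ hv, mk_eq_of_eq hv e, hc⟩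

lemma isClosed_conic (a b : ℂ) :
    IsClosed {p : P2 | ∃ (x y z : ℂ) (h : ![x, y, z] ≠ 0),
        p = Projectivization.mk ℂ ![x, y, z] h ∧ x * y * a = b * z ^ 2} := by
  have hq : Topology.IsQuotientMap
      (Quotient.mk (projectivizationSetoid ℂ (Fin 3 → ℂ))) := isQuotientMap_quotient_mk'
  refine hq.isClosed_preimage.1 ?_
  have : IsClosed {v : {v : Fin 3 → ℂ // v ≠ 0} |
      v.1 0 * v.1 1 * a = b * v.1 2 ^ 2} :=
    by
      have hi : ∀ i : Fin 3, Continuous (fun v : {v : Fin 3 → ℂ // v ≠ 0} => v.1 i) :=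
        fun i => (continuous_apply i).comp continuous_subtype_val
      exact isClosed_eq (((hi 0).mul (hi 1)).mul continuous_const)
        (continuous_const.mul ((hi 2).pow 2))
  convert this using 1
  ext v
  exact mk_mem_conic_iff a b v.1 v.2

lemma mem_orbit_aux (x₀ y₀ z₀ : ℂ) (hz₀ : z₀ ≠ 0) (v : Fin 3 → ℂ) (hv : v ≠ 0)
    (l c : ℂ) (hl : l ≠ 0) (h0 : v 0 = c * (l * x₀)) (h1 : v 1 * l = c * y₀)
    (h2 : v 2 = c * z₀) :
    (Projectivization.mk ℂ v hv : P2) ∈ MulAction.orbit ℂˣ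
        (Projectivization.mk ℂ ![x₀, y₀, z₀] (ne_zero_of_coord 2 hz₀) : P2) := by
  refine ⟨Units.mk0 l hl, ?_⟩
  show Units.mk0 l hl • _ = _
  rw [smul_mk]
  symm
  rw [Projectivization.mk_eq_mk_iff']
  refine ⟨c, ?_⟩
  funext i
  fin_cases i
  · simp [wt, h0]
  · simp [wt]; field_simp; linear_combination -h1
  · simp [wt, h2]

/-- The closure of the orbit of a generic point `[x₀:y₀:z₀]` is the full conic
`x·y·z₀² = x₀·y₀·z²`; equivalently it is the orbit together with exactly the two points
`[1:0:0]` and `[0:1:0]`. -/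
theorem closure_orbit_generic (x₀ y₀ z₀ : ℂ)
    (hx₀ : x₀ ≠ 0) (hy₀ : y₀ ≠ 0) (hz₀ : z₀ ≠ 0) :
    closure (MulAction.orbit ℂˣ
        (Projectivization.mk ℂ ![x₀, y₀, z₀] (ne_zero_of_coord 2 hz₀))) =
      {p : P2 | ∃ (x y z : ℂ) (h : ![x, y, z] ≠ 0),
        p = Projectivization.mk ℂ ![x, y, z] h ∧ x * y * z₀ ^ 2 = x₀ * y₀ * z ^ 2} ∧
    closure (MulAction.orbit ℂˣ
        (Projectivization.mk ℂ ![x₀, y₀, z₀] (ne_zero_of_coord 2 hz₀))) =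
      MulAction.orbit ℂˣ (Projectivization.mk ℂ ![x₀, y₀, z₀] (ne_zero_of_coord 2 hz₀)) ∪
        {Projectivization.mk ℂ ![1, 0, 0] (ne_zero_of_coord 0 one_ne_zero),
         Projectivization.mk ℂ ![0, 1, 0] (ne_zero_of_coord 1 one_ne_zero)} := by
  have hC : ∀ p : P2, p ∈ {p : P2 | ∃ (x y z : ℂ) (h : ![x, y, z] ≠ 0),
        p = Projectivization.mk ℂ ![x, y, z] h ∧ x * y * z₀ ^ 2 = x₀ * y₀ * z ^ 2} →
      p ∈ MulAction.orbit ℂˣ (Projectivization.mk ℂ ![x₀, y₀, z₀] (ne_zero_of_coord 2 hz₀)) ∪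
        {Projectivization.mk ℂ ![1, 0, 0] (ne_zero_of_coord 0 one_ne_zero),
         Projectivization.mk ℂ ![0, 1, 0] (ne_zero_of_coord 1 one_ne_zero)} := by
    rintro p ⟨x, y, z, h, rfl, hc⟩
    by_cases hz : z = 0
    · right
      subst hz
      have hxy : x = 0 ∨ y = 0 := by
        have : x * y * z₀ ^ 2 = 0 := by rw [hc]; ring
        simpa [hz₀] using this
      rcases hxy with rfl | rfl
      · right
        refine (Projectivization.mk_eq_mk_iff' ℂ _ _ _ _).2 ⟨y, ?_⟩
        funext i; fin_cases i <;> simp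
      · left
        refine (Projectivization.mk_eq_mk_iff' ℂ _ _ _ _).2 ⟨x, ?_⟩
        funext i; fin_cases i <;> simp
    · left
      have hx : x ≠ 0 := by
        rintro rfl
        have : x₀ * y₀ * z ^ 2 = 0 := by rw [← hc]; ring
        simp [hx₀, hy₀, hz] at this
      refine mem_orbit_aux x₀ y₀ z₀ hz₀ _ h (x * z₀ / (z * x₀)) (z / z₀) (by positivity) ?_ ?_ ?_
      · simp; field_simp
      · simp; field_simp; linear_combination hc
      · simp; field_simp
  have hP : MulAction.orbit ℂˣ (Projectivization.mk ℂ ![x₀, y₀, z₀] (ne_zero_of_coord 2 hz₀)) ∪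
        {Projectivization.mk ℂ ![1, 0, 0] (ne_zero_of_coord 0 one_ne_zero),
         Projectivization.mk ℂ ![0, 1, 0] (ne_zero_of_coord 1 one_ne_zero)} ⊆
      closure (MulAction.orbit ℂˣ
        (Projectivization.mk ℂ ![x₀, y₀, z₀] (ne_zero_of_coord 2 hz₀) : P2)) := by
    have h00 : (0 : ℂ) ∈ closure ({0}ᶜ : Set ℂ) := by simp
    refine Set.union_subset subset_closure ?_
    rintro p (rfl | rfl)
    · have hf := continuous_mk_aux (fun t => ![x₀, t ^ 2 * y₀, t * z₀])
        (by refine continuous_pi fun i => ?_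
            fin_cases i <;> simp <;> fun_prop) (fun t => ne_zero_of_coord 0 hx₀)
      have := map_mem_closure hf h00 (t := MulAction.orbit ℂˣ
        (Projectivization.mk ℂ ![x₀, y₀, z₀] (ne_zero_of_coord 2 hz₀) : P2)) (by
          intro t ht
          have ht : t ≠ 0 := ht
          refine mem_orbit_aux x₀ y₀ z₀ hz₀ _ _ t⁻¹ t (inv_ne_zero ht) ?_ ?_ ?_
          · simp; field_simp
          · simp; field_simp
          · simp)
      convert this using 1
      refine (Projectivization.mk_eq_mk_iff' ℂ _ _ _ _).2 ⟨x₀⁻¹, ?_⟩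
      funext i; fin_cases i <;> simp [hx₀]
    · have hf := continuous_mk_aux (fun t => ![t ^ 2 * x₀, y₀, t * z₀])
        (by refine continuous_pi fun i => ?_
            fin_cases i <;> simp <;> fun_prop) (fun t => ne_zero_of_coord 1 hy₀)
      have := map_mem_closure hf h00 (t := MulAction.orbit ℂˣ
        (Projectivization.mk ℂ ![x₀, y₀, z₀] (ne_zero_of_coord 2 hz₀) : P2)) (by
          intro t ht
          have ht : t ≠ 0 := ht
          refine mem_orbit_aux x₀ y₀ z₀ hz₀ _ _ t t ht ?_ ?_ ?_
          · simp; ring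
          · simp; ring
          · simp)
      convert this using 1
      refine (Projectivization.mk_eq_mk_iff' ℂ _ _ _ _).2 ⟨y₀⁻¹, ?_⟩
      funext i; fin_cases i <;> simp [hy₀]
  have hK := closure_minimal (s := MulAction.orbit ℂˣ
        (Projectivization.mk ℂ ![x₀, y₀, z₀] (ne_zero_of_coord 2 hz₀) : P2)) (by
      rintro p ⟨l, rfl⟩
      show l • _ ∈ _
      rw [smul_mk]
      refine (mk_mem_conic_iff (z₀ ^ 2) (x₀ * y₀) _ _).2 ?_
      simp [wt]
      field_simp
      simp) (isClosed_conic (z₀ ^ 2) (x₀ * y₀))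
  exact ⟨hK.antisymm fun p hp => hP (hC p hp), Set.Subset.antisymm (fun p hp => hC p (hK hp)) hP⟩
end
end

section
/- Let D = ℙ²(ℂ) ∖ {[1:0:0], [0:1:0]}. The formula q([x:y:z]) = [xy : z²] defines a map q : D → ℙ¹(ℂ) (on D, xy and z² are not both zero, and the value is independent of the homogeneous representative) which is continuous, surjective, and constant on ℂˣ-orbits of the action λ·[x:y:z] = [λx : λ⁻¹y : z]. Moreover, for every b ∈ ℙ¹(ℂ) with b ≠ [0:1], the fiber q⁻¹(b) is a single ℂˣ-orbit, while q⁻¹([0:1]) = {[x:y:z] ∈ ℙ²(ℂ) : xy = 0 and z ≠ 0}, which is the union of the three orbits ℂˣ·[0:1:1], ℂˣ·[1:0:1] and {[0:0:1]}. -/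
noncomputable section

open Projectivization
open scoped LinearAlgebra.Projectivization

/-- The complex projective line `ℙ¹(ℂ)`. -/
abbrev P1 := ℙ ℂ (Fin 2 → ℂ)

/-- The semistable locus `D = ℙ² ∖ {[1:0:0], [0:1:0]}` for the wall linearization. -/
def D : Set P2 :=
  {p | p ≠ Projectivization.mk ℂ ![1, 0, 0] (ne_zero_of_coord 0 one_ne_zero) ∧
       p ≠ Projectivization.mk ℂ ![0, 1, 0] (ne_zero_of_coord 1 one_ne_zero)}

lemma quad_ne_iff (x y z : ℂ) : (![x * y, z ^ 2] : Fin 2 → ℂ) ≠ 0 ↔ (x * y ≠ 0 ∨ z ≠ 0) := by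
  rw [Ne, funext_iff, Fin.forall_fin_two]
  simp only [Matrix.cons_val_zero, Matrix.cons_val_one, Pi.zero_apply]
  rw [not_and_or, pow_eq_zero_iff two_ne_zero]

lemma mem_D_iff (v : Fin 3 → ℂ) (hv : v ≠ 0) :
    Projectivization.mk ℂ v hv ∈ D ↔ (v 0 * v 1 ≠ 0 ∨ v 2 ≠ 0) := by
  have hv' : ¬ (v 0 = 0 ∧ v 1 = 0 ∧ v 2 = 0) := by
    rintro ⟨h0, h1, h2⟩
    apply hv
    funext i
    fin_cases i <;> simp [h0, h1, h2]
  simp only [D, Set.mem_ofPred_eq, Ne, Projectivization.mk_eq_mk_iff', funext_iff,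
    Fin.forall_fin_succ, Pi.smul_apply, smul_eq_mul]
  simp
  constructor
  · rintro ⟨h1, h2⟩
    by_contra! h
    obtain ⟨h3, h4⟩ := h
    by_cases h0 : v 0 = 0
    · exact h2 h0.symm h4.symm
    · exact h1 (h3 h0).symm h4.symm
  · intro h
    constructor
    · intro h1 h2
      rcases h with h | h
      · exact h.2 h1.symm
      · exact h h2.symm
    · intro h1 h2
      rcases h with h | h
      · exact h.1 h1.symm
      · exact h h2.symm

/-- The quotient map on representatives. -/
def qfun (p : D) : P1 :=
  Projectivization.mk ℂ ![p.1.rep 0 * p.1.rep 1, p.1.rep 2 ^ 2] (by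
    rw [quad_ne_iff, ← mem_D_iff _ p.1.rep_nonzero, Projectivization.mk_rep]
    exact p.2)

lemma qfun_mk (v : Fin 3 → ℂ) (hv : v ≠ 0) (hD : Projectivization.mk ℂ v hv ∈ D)
    (h2 : (![v 0 * v 1, v 2 ^ 2] : Fin 2 → ℂ) ≠ 0) :
    qfun ⟨Projectivization.mk ℂ v hv, hD⟩ = Projectivization.mk ℂ ![v 0 * v 1, v 2 ^ 2] h2 := by
  obtain ⟨a, ha⟩ := Projectivization.exists_smul_eq_mk_rep ℂ v hv
  unfold qfun
  rw [Projectivization.mk_eq_mk_iff']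
  refine ⟨(a : ℂ) ^ 2, ?_⟩
  simp only [← ha]
  funext i
  fin_cases i <;> simp [Units.smul_def] <;> ring

lemma qfun_mk3 (x y z : ℂ) (hv : ![x, y, z] ≠ 0) (hD : Projectivization.mk ℂ ![x, y, z] hv ∈ D)
    (h2 : (![x * y, z ^ 2] : Fin 2 → ℂ) ≠ 0) :
    qfun ⟨Projectivization.mk ℂ ![x, y, z] hv, hD⟩ = Projectivization.mk ℂ ![x * y, z ^ 2] h2 :=
  qfun_mk ![x, y, z] hv hD h2

lemma P2_ind {C : P2 → Prop}
    (h : ∀ (x y z : ℂ) (hv : ![x, y, z] ≠ 0), C (Projectivization.mk ℂ ![x, y, z] hv)) (p : P2) :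
    C p := by
  induction p using Projectivization.ind with
  | h v hv =>
    have : v = ![v 0, v 1, v 2] := by
      funext i; fin_cases i <;> rfl
    rw [mk_eq_of_eq hv this]
    exact h _ _ _ _

lemma P1_ind {C : P1 → Prop}
    (h : ∀ (x y : ℂ) (hv : ![x, y] ≠ 0), C (Projectivization.mk ℂ ![x, y] hv)) (p : P1) :
    C p := by
  induction p using Projectivization.ind with
  | h v hv =>
    have : v = ![v 0, v 1] := by
      funext i; fin_cases i <;> rfl
    have key : ∀ w (hw : w ≠ 0), v = w → C (Projectivization.mk ℂ w hw) →
        C (Projectivization.mk ℂ v hv) := by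
      rintro w hw rfl h; exact h
    exact key _ (this ▸ hv) this (h _ _ _)

lemma mk3_eq_iff (x y z x' y' z' : ℂ) (h : ![x, y, z] ≠ 0) (h' : ![x', y', z'] ≠ 0) :
    Projectivization.mk ℂ ![x, y, z] h = Projectivization.mk ℂ ![x', y', z'] h' ↔
      ∃ a : ℂ, a * x' = x ∧ a * y' = y ∧ a * z' = z := by
  rw [Projectivization.mk_eq_mk_iff']
  simp [funext_iff, Fin.forall_fin_succ]

lemma mk2_eq_iff (x y x' y' : ℂ) (h : ![x, y] ≠ 0) (h' : ![x', y'] ≠ 0) :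
    Projectivization.mk ℂ ![x, y] h = Projectivization.mk ℂ ![x', y'] h' ↔
      ∃ a : ℂ, a * x' = x ∧ a * y' = y := by
  rw [Projectivization.mk_eq_mk_iff']
  simp [funext_iff, Fin.forall_fin_succ]

lemma smul_mk3 (lam : ℂˣ) (x y z : ℂ) (h : ![x, y, z] ≠ 0) :
    ∃ h' : ![(lam : ℂ) * x, (lam : ℂ)⁻¹ * y, z] ≠ 0, lam • Projectivization.mk ℂ ![x, y, z] h =
      Projectivization.mk ℂ ![(lam : ℂ) * x, (lam : ℂ)⁻¹ * y, z] h' := by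
  have e : (fun i => wt lam i * ![x, y, z] i) = ![(lam : ℂ) * x, (lam : ℂ)⁻¹ * y, z] := by
    funext i; fin_cases i <;> simp [wt]
  rw [smul_mk]
  exact ⟨_, mk_eq_of_eq _ e⟩

lemma mem_D3 (x y z : ℂ) (h : ![x, y, z] ≠ 0) :
    Projectivization.mk ℂ ![x, y, z] h ∈ D ↔ (x * y ≠ 0 ∨ z ≠ 0) := mem_D_iff _ h

lemma mem_orbit3 (x y z x' y' z' : ℂ) (h : ![x, y, z] ≠ 0) (h' : ![x', y', z'] ≠ 0) :
    Projectivization.mk ℂ ![x, y, z] h ∈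
      MulAction.orbit ℂˣ (Projectivization.mk ℂ ![x', y', z'] h') ↔
      ∃ (l : ℂˣ) (a : ℂ), a * x = l * x' ∧ a * y = (l : ℂ)⁻¹ * y' ∧ a * z = z' := by
  rw [MulAction.mem_orbit_iff]
  refine exists_congr fun l => ?_
  obtain ⟨h1, e⟩ := smul_mk3 l x' y' z' h'
  rw [e, mk3_eq_iff]

lemma mem_fiber3 (x y z a b : ℂ) (h : ![x, y, z] ≠ 0) (hb : ![a, b] ≠ 0) :
    Projectivization.mk ℂ ![x, y, z] h ∈
      Subtype.val '' (qfun ⁻¹' {Projectivization.mk ℂ ![a, b] hb}) ↔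
      (x * y ≠ 0 ∨ z ≠ 0) ∧ ∃ k : ℂ, k * a = x * y ∧ k * b = z ^ 2 := by
  constructor
  · rintro ⟨⟨p, hp⟩, hq, e⟩
    simp only at e
    subst e
    have h3 := (mem_D3 x y z h).1 hp
    refine ⟨h3, ?_⟩
    rw [Set.mem_preimage, Set.mem_singleton_iff,
      qfun_mk3 x y z h hp ((quad_ne_iff x y z).2 h3), mk2_eq_iff] at hq
    exact hq
  · rintro ⟨h3, hk⟩
    refine ⟨⟨_, (mem_D3 x y z h).2 h3⟩, ?_, rfl⟩
    rw [Set.mem_preimage, Set.mem_singleton_iff,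
      qfun_mk3 x y z h _ ((quad_ne_iff x y z).2 h3), mk2_eq_iff]
    exact hk

/-- The projection from nonzero vectors. -/
def pr (n : ℕ) (v : {v : Fin n → ℂ // v ≠ 0}) : ℙ ℂ (Fin n → ℂ) := Projectivization.mk ℂ v.1 v.2

lemma pr_quot (n : ℕ) : Topology.IsQuotientMap (pr n) := isQuotientMap_quotient_mk'

lemma D_preimage : pr 3 ⁻¹' D = {v | v.1 0 * v.1 1 ≠ 0 ∨ v.1 2 ≠ 0} := by
  ext v
  exact mem_D_iff v.1 v.2

lemma coord_cont (n : ℕ) (i : Fin n) :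
    Continuous fun v : {v : Fin n → ℂ // v ≠ 0} => v.1 i :=
  (continuous_apply i).comp continuous_subtype_val

lemma D_open : IsOpen D := by
  rw [← (pr_quot 3).isOpen_preimage, D_preimage]
  exact IsOpen.union
    (isOpen_ne_fun ((coord_cont 3 0).mul (coord_cont 3 1)) continuous_const)
    (isOpen_ne_fun (coord_cont 3 2) continuous_const)

lemma qfun_cont : Continuous qfun := by
  have h := (pr_quot 3).restrictPreimage_isOpen D_open
  rw [h.continuous_iff]
  have h2 : ∀ v : pr 3 ⁻¹' D, (![v.1.1 0 * v.1.1 1, v.1.1 2 ^ 2] : Fin 2 → ℂ) ≠ 0 := fun v =>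
    (quad_ne_iff _ _ _).2 ((mem_D_iff v.1.1 v.1.2).1 v.2)
  have e : qfun ∘ D.restrictPreimage (pr 3) = pr 2 ∘ fun v => ⟨_, h2 v⟩ := by
    funext v
    exact qfun_mk v.1.1 v.1.2 v.2 (h2 v)
  rw [e]
  refine (pr_quot 2).continuous.comp (Continuous.subtype_mk ?_ _)
  refine continuous_pi fun i => ?_
  fin_cases i
  · exact ((coord_cont 3 0).mul (coord_cont 3 1)).comp continuous_subtype_val
  · exact ((coord_cont 3 2).pow 2).comp continuous_subtype_val

/-- On `D = ℙ² ∖ {[1:0:0], [0:1:0]}`, the formula `q([x:y:z]) = [xy : z²]` gives a well-defined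
continuous surjection `q : D → ℙ¹`, constant on `ℂˣ`-orbits; every fiber over `b ≠ [0:1]` is a
single orbit, and the fiber over `[0:1]` is `{xy = 0, z ≠ 0}`, the union of the three orbits of
`[0:1:1]`, `[1:0:1]` and `[0:0:1]`. -/
theorem wall_quotient_map :
    (∀ (x y z : ℂ) (h : ![x, y, z] ≠ 0),
      Projectivization.mk ℂ ![x, y, z] h ∈ D → ![x * y, z ^ 2] ≠ 0) ∧
    ∃ q : D → P1,
      (∀ (x y z : ℂ) (h : ![x, y, z] ≠ 0) (hD : Projectivization.mk ℂ ![x, y, z] h ∈ D)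
          (h2 : ![x * y, z ^ 2] ≠ 0),
        q ⟨Projectivization.mk ℂ ![x, y, z] h, hD⟩ =
          Projectivization.mk ℂ ![x * y, z ^ 2] h2) ∧
      Continuous q ∧ Function.Surjective q ∧
      (∀ (p : P2) (hp : p ∈ D) (lam : ℂˣ) (hp' : lam • p ∈ D),
        q ⟨lam • p, hp'⟩ = q ⟨p, hp⟩) ∧
      (∀ b : P1, b ≠ Projectivization.mk ℂ ![0, 1] (ne_zero_of_coord 1 one_ne_zero) →
        ∃ p : P2, Subtype.val '' (q ⁻¹' {b}) = MulAction.orbit ℂˣ p) ∧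
      Subtype.val ''
          (q ⁻¹' {Projectivization.mk ℂ ![0, 1] (ne_zero_of_coord 1 one_ne_zero)}) =
        {p : P2 | ∃ (x y z : ℂ) (h : ![x, y, z] ≠ 0),
          p = Projectivization.mk ℂ ![x, y, z] h ∧ x * y = 0 ∧ z ≠ 0} ∧
      Subtype.val ''
          (q ⁻¹' {Projectivization.mk ℂ ![0, 1] (ne_zero_of_coord 1 one_ne_zero)}) =
        MulAction.orbit ℂˣ
            (Projectivization.mk ℂ ![0, 1, 1] (ne_zero_of_coord 2 one_ne_zero)) ∪
          MulAction.orbit ℂˣ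
            (Projectivization.mk ℂ ![1, 0, 1] (ne_zero_of_coord 2 one_ne_zero)) ∪
          {Projectivization.mk ℂ ![0, 0, 1] (ne_zero_of_coord 2 one_ne_zero)} := by
  refine ⟨fun x y z h hD => (quad_ne_iff x y z).2 ((mem_D3 x y z h).1 hD), qfun, qfun_mk3,
    qfun_cont, ?_, ?_, ?_, ?_, ?_⟩
  · intro b
    induction b using P1_ind with
    | h a b hb =>
      obtain ⟨s, hs⟩ := IsAlgClosed.exists_pow_nat_eq b (n := 2) two_pos
      have h0 : (![a, 1, s] : Fin 3 → ℂ) ≠ 0 := ne_zero_of_coord 1 one_ne_zero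
      have hm : Projectivization.mk ℂ ![a, 1, s] h0 ∈
          Subtype.val '' (qfun ⁻¹' {Projectivization.mk ℂ ![a, b] hb}) := by
        rw [mem_fiber3]
        refine ⟨?_, 1, by ring, by rw [hs]; ring⟩
        rw [← quad_ne_iff, hs, mul_one]
        exact hb
      obtain ⟨p, hp, -⟩ := hm
      exact ⟨p, hp⟩
  · intro p
    induction p using P2_ind with
    | h x y z h =>
      intro hp lam hp'
      obtain ⟨h', e⟩ := smul_mk3 lam x y z h
      have hl := lam.ne_zero
      have e2 : (⟨lam • Projectivization.mk ℂ ![x, y, z] h, hp'⟩ : D) = ⟨_, e ▸ hp'⟩ :=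
        Subtype.ext e
      have h3 := (mem_D3 _ _ _ _).1 hp
      have h4 := (mem_D3 _ _ _ _).1 (e ▸ hp')
      rw [e2, qfun_mk3 _ _ _ _ _ ((quad_ne_iff _ _ _).2 h3),
        qfun_mk3 _ _ _ _ _ ((quad_ne_iff _ _ _).2 h4), mk2_eq_iff]
      refine ⟨1, ?_, by ring⟩
      field_simp
  · intro b
    induction b using P1_ind with
    | h a b hb =>
      intro hne
      have ha : a ≠ 0 := by
        rintro rfl
        apply hne
        rw [mk2_eq_iff]
        exact ⟨b, by ring, by ring⟩
      obtain ⟨s, hs⟩ := IsAlgClosed.exists_pow_nat_eq b (n := 2) two_pos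
      have h0 : (![a, 1, s] : Fin 3 → ℂ) ≠ 0 := ne_zero_of_coord 1 one_ne_zero
      refine ⟨Projectivization.mk ℂ ![a, 1, s] h0, ?_⟩
      ext p
      induction p using P2_ind with
      | h x y z h =>
        rw [mem_fiber3, mem_orbit3]
        constructor
        · rintro ⟨hD, k, h1, h2⟩
          have hk : k ≠ 0 := by
            rintro rfl
            rcases hD with hD | hD
            · exact hD (by rw [← h1]; ring)
            · exact hD (by rw [← sq_eq_zero_iff, ← h2]; ring)
          have hxy : x * y ≠ 0 := h1 ▸ mul_ne_zero hk ha
          obtain ⟨r, hr⟩ := IsAlgClosed.exists_pow_nat_eq k (n := 2) two_pos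
          have hr0 : r ≠ 0 := by rintro rfl; exact hk (by rw [← hr]; ring)
          have hx := left_ne_zero_of_mul hxy
          have hy := right_ne_zero_of_mul hxy
          have : ∃ r : ℂ, r ^ 2 = k ∧ r ≠ 0 ∧ z = r * s := by
            have : z ^ 2 = (r * s) ^ 2 := by rw [← h2, ← hr, ← hs]; ring
            rcases sq_eq_sq_iff_eq_or_eq_neg.1 this with h | h
            · exact ⟨r, hr, hr0, h⟩
            · exact ⟨-r, by rw [← hr]; ring, neg_ne_zero.2 hr0, by rw [h]; ring⟩
          obtain ⟨r, hr, hr0, hz⟩ := this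
          refine ⟨Units.mk0 (r / y) (div_ne_zero hr0 hy), r⁻¹, ?_, ?_, ?_⟩
          · simp only [Units.val_mk0]
            field_simp
            rw [hr, ← h1]
          · simp only [Units.val_mk0]
            field_simp
          · rw [hz]; field_simp
        · rintro ⟨l, c, h1, h2, h3⟩
          have hl := l.ne_zero
          have hc : c ≠ 0 := by
            rintro rfl
            rw [zero_mul] at h1
            exact mul_ne_zero hl ha h1.symm
          have e1 : c ^ 2 * (x * y) = a := by
            have : c ^ 2 * (x * y) = (c * x) * (c * y) := by ring
            rw [this, h1, h2]; field_simp
          refine ⟨Or.inl ?_, (c ^ 2)⁻¹, ?_, ?_⟩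
          · intro h; apply ha; rw [← e1, h, mul_zero]
          · rw [← e1]; field_simp
          · rw [← hs, ← h3]; field_simp
  · ext p
    induction p using P2_ind with
    | h x y z h =>
      rw [mem_fiber3]
      constructor
      · rintro ⟨hD, k, h1, h2⟩
        have hxy : x * y = 0 := by rw [← h1]; ring
        exact ⟨x, y, z, h, rfl, hxy, hD.resolve_left (fun h => h hxy)⟩
      · rintro ⟨x', y', z', h', e, hxy, hz⟩
        rw [eq_comm, mk3_eq_iff] at e
        obtain ⟨a, rfl, rfl, rfl⟩ := e
        have ha := left_ne_zero_of_mul hz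
        refine ⟨Or.inr (right_ne_zero_of_mul hz), z ^ 2, ?_, by ring⟩
        have : a ^ 2 * (x * y) = 0 := by rw [← hxy]; ring
        rcases mul_eq_zero.1 this with h | h
        · exact absurd h (pow_ne_zero 2 ha)
        · rw [h]; ring
  · ext p
    induction p using P2_ind with
    | h x y z h =>
      rw [mem_fiber3, Set.mem_union, Set.mem_union, mem_orbit3, mem_orbit3,
        Set.mem_singleton_iff, mk3_eq_iff]
      constructor
      · rintro ⟨hD, k, h1, h2⟩
        have hxy : x * y = 0 := by rw [← h1]; ring
        have hz : z ≠ 0 := hD.resolve_left (fun h => h hxy)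
        by_cases hx : x = 0
        · by_cases hy : y = 0
          · exact Or.inr ⟨z, by rw [hx]; ring, by rw [hy]; ring, by ring⟩
          · refine Or.inl (Or.inl ⟨Units.mk0 (z / y) (div_ne_zero hz hy), z⁻¹, ?_, ?_, ?_⟩)
            · rw [hx]; ring
            · simp only [Units.val_mk0]; field_simp
            · field_simp
        · have hy : y = 0 := (mul_eq_zero.1 hxy).resolve_left hx
          refine Or.inl (Or.inr ⟨Units.mk0 (x / z) (div_ne_zero hx hz), z⁻¹, ?_, ?_, ?_⟩)
          · simp only [Units.val_mk0]; field_simp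
          · rw [hy]; ring
          · field_simp
      · have fin : z ≠ 0 → x * y = 0 →
            ((x * y ≠ 0 ∨ z ≠ 0) ∧ ∃ k : ℂ, k * 0 = x * y ∧ k * 1 = z ^ 2) := fun hz hxy =>
          ⟨Or.inr hz, z ^ 2, by rw [hxy]; ring, by ring⟩
        rintro ((⟨l, c, h1, h2, h3⟩ | ⟨l, c, h1, h2, h3⟩) | ⟨c, h1, h2, h3⟩)
        · have hc : c ≠ 0 := by rintro rfl; simp at h3
          have hz : z ≠ 0 := by rintro rfl; simp at h3
          refine fin hz ?_
          rw [mul_zero] at h1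
          rw [(mul_eq_zero.1 h1).resolve_left hc, zero_mul]
        · have hc : c ≠ 0 := by rintro rfl; simp at h3
          have hz : z ≠ 0 := by rintro rfl; simp at h3
          refine fin hz ?_
          rw [mul_zero] at h2
          rw [(mul_eq_zero.1 h2).resolve_left hc, mul_zero]
        · have hx : x = 0 := by rw [← h1]; ring
          have hy : y = 0 := by rw [← h2]; ring
          refine fin ?_ (by rw [hx]; ring)
          rintro rfl
          apply h
          rw [hx, hy]
          funext i; fin_cases i <;> rfl
end
end

section
/- Let U = {[x:y:z:w] ∈ ℙ³(ℂ) : z ≠ 0} ∖ {[0:0:1:0]}. Then U is invariant under the ℂˣ-action λ·[x:y:z:w] = [λx : λy : λ⁻¹z : w], the formula Q([x:y:z:w]) = [xz : yz : w²] defines a well-defined continuous surjection Q : U → ℙ²(ℂ) (on U the triple (xz, yz, w²) is never (0,0,0), and the value is independent of the homogeneous representative), and the fibers of Q are precisely the ℂˣ-orbits contained in U. -/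
noncomputable section

open Projectivization
open scoped LinearAlgebra.Projectivization

/-- Complex projective 3-space `ℙ³(ℂ)`. -/
abbrev P3 := ℙ ℂ (Fin 4 → ℂ)

/-- The weights of the `ℂˣ`-action `λ·[x:y:z:w] = [λx : λy : λ⁻¹z : w]`. -/
def wt4 (lam : ℂˣ) : Fin 4 → ℂ := ![(lam : ℂ), (lam : ℂ), ((lam⁻¹ : ℂˣ) : ℂ), 1]

lemma wt4_ne (lam : ℂˣ) (i : Fin 4) : wt4 lam i ≠ 0 := by
  fin_cases i <;> simp [wt4]

/-- The linear map `(x, y, z, w) ↦ (λx, λy, λ⁻¹z, w)`. -/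
def actMap4 (lam : ℂˣ) : (Fin 4 → ℂ) →ₗ[ℂ] (Fin 4 → ℂ) where
  toFun v := fun i => wt4 lam i * v i
  map_add' a b := by funext i; simp [mul_add]
  map_smul' c a := by funext i; simp [Pi.smul_apply, smul_eq_mul]; ring

lemma actMap4_inj (lam : ℂˣ) : Function.Injective (actMap4 lam) := by
  intro v w h
  funext i
  exact mul_left_cancel₀ (wt4_ne lam i) (congrFun h i)

/-- The action `λ·[x:y:z:w] = [λx : λy : λ⁻¹z : w]` of `ℂˣ` on `ℙ³(ℂ)`. -/
instance : SMul ℂˣ P3 := ⟨fun lam => Projectivization.map (actMap4 lam) (actMap4_inj lam)⟩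

lemma smul_mk4 (lam : ℂˣ) (v : Fin 4 → ℂ) (hv : v ≠ 0) :
    lam • Projectivization.mk ℂ v hv =
      Projectivization.mk ℂ (fun i => wt4 lam i * v i)
        (fun H => hv (actMap4_inj lam (H.trans (map_zero (actMap4 lam)).symm))) := by
  exact Projectivization.map_mk (actMap4 lam) (actMap4_inj lam) v hv

lemma mk_eq_of_eq4 {v w : Fin 4 → ℂ} (hv : v ≠ 0) (h : v = w) :
    Projectivization.mk ℂ v hv = Projectivization.mk ℂ w (h ▸ hv) := by subst h; rfl

instance : MulAction ℂˣ P3 where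
  one_smul p := by
    induction p using Projectivization.ind with
    | h v hv =>
      rw [smul_mk4]
      refine (mk_eq_of_eq4 _ ?_).symm
      funext i; fin_cases i <;> simp [wt4]
  mul_smul a b p := by
    induction p using Projectivization.ind with
    | h v hv =>
      rw [smul_mk4, smul_mk4, smul_mk4]
      refine mk_eq_of_eq4 _ ?_
      funext i; fin_cases i <;> simp [wt4] <;> ring

/-- The stable locus `U = {z ≠ 0} ∖ {[0:0:1:0]}` for the chamber `[−1,0]`. -/
def U : Set P3 :=
  {p | ∃ (x y z w : ℂ) (h : ![x, y, z, w] ≠ 0),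
    p = Projectivization.mk ℂ ![x, y, z, w] h ∧ z ≠ 0 ∧ (x ≠ 0 ∨ y ≠ 0 ∨ w ≠ 0)}

lemma aux_mem_U (v : Fin 4 → ℂ) (hv : v ≠ 0) :
    Projectivization.mk ℂ v hv ∈ U ↔ v 2 ≠ 0 ∧ (v 0 ≠ 0 ∨ v 1 ≠ 0 ∨ v 3 ≠ 0) := by
  constructor
  · rintro ⟨x, y, z, w, h, he, hz, hx⟩
    obtain ⟨a, ha⟩ := (Projectivization.mk_eq_mk_iff' ℂ _ _ hv h).1 he
    have ha0 : a ≠ 0 := by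
      rintro rfl
      exact hv (by rw [← ha, zero_smul])
    subst ha
    simpa [ha0] using And.intro hz hx
  · rintro ⟨h2, h⟩
    have e : v = ![v 0, v 1, v 2, v 3] := by
      funext i; fin_cases i <;> rfl
    exact ⟨v 0, v 1, v 2, v 3, e ▸ hv, mk_eq_of_eq4 hv e, h2, h⟩

/-- The affine lift of the quotient map. -/
def auxq (v : Fin 4 → ℂ) : Fin 3 → ℂ := ![v 0 * v 2, v 1 * v 2, v 3 ^ 2]

lemma auxq_ne {v : Fin 4 → ℂ} (h : v 2 ≠ 0 ∧ (v 0 ≠ 0 ∨ v 1 ≠ 0 ∨ v 3 ≠ 0)) : auxq v ≠ 0 := by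
  obtain ⟨h2, h | h | h⟩ := h
  · exact ne_zero_of_coord 0 (by simpa [auxq] using ⟨h, h2⟩)
  · exact ne_zero_of_coord 1 (by simpa [auxq] using ⟨h, h2⟩)
  · exact ne_zero_of_coord 2 (by simpa [auxq] using h)

lemma auxq_smul (a : ℂ) (v : Fin 4 → ℂ) : auxq (a • v) = (a ^ 2) • auxq v := by
  funext i; fin_cases i <;> simp [auxq] <;> ring

lemma aux_rep_mem (p : U) :
    p.1.rep 2 ≠ 0 ∧ (p.1.rep 0 ≠ 0 ∨ p.1.rep 1 ≠ 0 ∨ p.1.rep 3 ≠ 0) := by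
  rw [← aux_mem_U _ p.1.rep_nonzero, Projectivization.mk_rep]
  exact p.2

/-- The quotient map. -/
def auxQ (p : U) : P2 := Projectivization.mk ℂ (auxq p.1.rep) (auxq_ne (aux_rep_mem p))

lemma auxQ_mk (v : Fin 4 → ℂ) (hv : v ≠ 0) (hU : Projectivization.mk ℂ v hv ∈ U)
    (h3 : auxq v ≠ 0) :
    auxQ ⟨Projectivization.mk ℂ v hv, hU⟩ = Projectivization.mk ℂ (auxq v) h3 := by
  unfold auxQ
  rw [Projectivization.mk_eq_mk_iff']
  obtain ⟨a, ha⟩ := Projectivization.exists_smul_eq_mk_rep ℂ v hv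
  refine ⟨(a : ℂ) ^ 2, ?_⟩
  rw [← auxq_smul]
  exact congrArg auxq ha

lemma aux_quot (n : ℕ) : Topology.IsQuotientMap
    (Projectivization.mk' ℂ : {v : Fin n → ℂ // v ≠ 0} → ℙ ℂ (Fin n → ℂ)) :=
  isQuotientMap_quot_mk

lemma aux_open : IsOpen U := by
  rw [← (aux_quot 4).isOpen_preimage]
  have : (Projectivization.mk' ℂ : {v : Fin 4 → ℂ // v ≠ 0} → P3) ⁻¹' U =
      {v | v.1 2 ≠ 0 ∧ (v.1 0 ≠ 0 ∨ v.1 1 ≠ 0 ∨ v.1 3 ≠ 0)} := by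
    ext v
    exact aux_mem_U v.1 v.2
  rw [this]
  have hc : ∀ i : Fin 4, IsOpen {v : {v : Fin 4 → ℂ // v ≠ 0} | v.1 i ≠ 0} := fun i =>
    isOpen_ne_fun ((continuous_apply i).comp continuous_subtype_val) continuous_const
  exact (hc 2).inter ((hc 0).union ((hc 1).union (hc 3)))

lemma aux_cont : Continuous auxQ := by
  rw [((aux_quot 4).restrictPreimage_isOpen aux_open).continuous_iff]
  have hm : ∀ v : (Projectivization.mk' ℂ : {v : Fin 4 → ℂ // v ≠ 0} → P3) ⁻¹' U,
      auxq v.1.1 ≠ 0 := fun v => auxq_ne ((aux_mem_U v.1.1 v.1.2).1 v.2)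
  have e : auxQ ∘ (U.restrictPreimage (Projectivization.mk' ℂ)) =
      (Projectivization.mk' ℂ) ∘ fun v => (⟨auxq v.1.1, hm v⟩ : {v : Fin 3 → ℂ // v ≠ 0}) := by
    funext v
    exact auxQ_mk v.1.1 v.1.2 v.2 (hm v)
  rw [e]
  refine (aux_quot 3).continuous.comp (Continuous.subtype_mk ?_ _)
  refine continuous_pi fun i => ?_
  have hc : ∀ j : Fin 4, Continuous
      fun v : (Projectivization.mk' ℂ : {v : Fin 4 → ℂ // v ≠ 0} → P3) ⁻¹' U => v.1.1 j := fun j =>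
    (continuous_apply j).comp (continuous_subtype_val.comp continuous_subtype_val)
  fin_cases i
  · exact (hc 0).mul (hc 2)
  · exact (hc 1).mul (hc 2)
  · exact (hc 3).pow 2

lemma aux_inv (p : P3) (hp : p ∈ U) (lam : ℂˣ) : lam • p ∈ U := by
  induction p using Projectivization.ind with
  | h v hv =>
    rw [smul_mk4, aux_mem_U]
    rw [aux_mem_U] at hp
    simpa [wt4_ne] using hp

lemma aux_surj : Function.Surjective auxQ := by
  intro p
  induction p using Projectivization.ind with
  | h v hv =>
    obtain ⟨w, hw⟩ := IsAlgClosed.exists_pow_nat_eq (v 2) (n := 2) (by norm_num)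
    have e : auxq ![v 0, v 1, 1, w] = v := by
      funext i; fin_cases i <;> simp [auxq, hw]
    have h4 : ![v 0, v 1, 1, w] ≠ 0 := ne_zero_of_coord 2 (by simp)
    have hU : Projectivization.mk ℂ ![v 0, v 1, 1, w] h4 ∈ U := by
      rw [aux_mem_U]
      refine ⟨by simp, ?_⟩
      by_contra! H
      simp at H
      obtain ⟨H0, H1, H2⟩ := H
      apply hv
      rw [← e]
      funext i; fin_cases i <;> simp [auxq, H0, H1, H2]
    refine ⟨⟨_, hU⟩, ?_⟩
    rw [auxQ_mk _ h4 hU (e.symm ▸ hv)]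
    congr 1

lemma aux_fiber (v v' : Fin 4 → ℂ) (hv : v ≠ 0) (hv' : v' ≠ 0)
    (h : Projectivization.mk ℂ v hv ∈ U) (h' : Projectivization.mk ℂ v' hv' ∈ U) :
    auxQ ⟨_, h'⟩ = auxQ ⟨_, h⟩ ↔
      ∃ lam : ℂˣ, lam • Projectivization.mk ℂ v hv = Projectivization.mk ℂ v' hv' := by
  have m := (aux_mem_U _ _).1 h
  have m' := (aux_mem_U _ _).1 h'
  rw [auxQ_mk v hv h (auxq_ne m), auxQ_mk v' hv' h' (auxq_ne m'), Projectivization.mk_eq_mk_iff']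
  simp_rw [smul_mk4, Projectivization.mk_eq_mk_iff']
  obtain ⟨h2, -⟩ := m
  obtain ⟨h2', m'⟩ := m'
  constructor
  · rintro ⟨c, hc⟩
    have c0 := congrFun hc 0
    have c1 := congrFun hc 1
    have c2 := congrFun hc 2
    simp [auxq] at c0 c1 c2
    have hc0 : c ≠ 0 := by
      rintro rfl
      simp [h2'] at c0 c1 c2
      grind
    obtain ⟨mu, hmu, hmu3⟩ : ∃ mu : ℂ, mu ^ 2 = c ∧ mu * v 3 = v' 3 := by
      obtain ⟨s, hs⟩ := IsAlgClosed.exists_pow_nat_eq c (n := 2) (by norm_num)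
      have : (s * v 3) ^ 2 = v' 3 ^ 2 := by rw [mul_pow, hs, c2]
      rcases sq_eq_sq_iff_eq_or_eq_neg.1 this with e | e
      · exact ⟨s, hs, e⟩
      · exact ⟨-s, by simpa using hs, by rw [neg_mul, e, neg_neg]⟩
    have hmu0 : mu ≠ 0 := by
      rintro rfl
      exact hc0 (by simpa using hmu.symm)
    refine ⟨Units.mk0 (mu * v 2 / v' 2) (by positivity), mu⁻¹, ?_⟩
    subst hmu
    funext i
    fin_cases i <;> simp [wt4]
    · field_simp
      linear_combination -c0
    · field_simp
      linear_combination -c1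
    · field_simp
    · field_simp
      linear_combination -hmu3
  · rintro ⟨lam, a, ha⟩
    have ha0 : a ≠ 0 := by
      rintro rfl
      rw [zero_smul] at ha
      exact mul_ne_zero (wt4_ne lam 2) h2 (congrFun ha 2).symm
    refine ⟨(a ^ 2)⁻¹, ?_⟩
    have e : auxq (fun i => wt4 lam i * v i) = auxq v := by
      have := lam.ne_zero
      funext i
      fin_cases i <;> simp [auxq, wt4] <;> field_simp
    rw [← e, ← ha, auxq_smul, smul_smul, inv_mul_cancel₀ (pow_ne_zero 2 ha0), one_smul]

theorem geometric_quotient_P3_chamber :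
    (∀ p ∈ U, ∀ lam : ℂˣ, lam • p ∈ U) ∧
    (∀ (x y z w : ℂ) (h : ![x, y, z, w] ≠ 0),
      Projectivization.mk ℂ ![x, y, z, w] h ∈ U → ![x * z, y * z, w ^ 2] ≠ 0) ∧
    ∃ Q : U → P2,
      (∀ (x y z w : ℂ) (h : ![x, y, z, w] ≠ 0)
          (hU : Projectivization.mk ℂ ![x, y, z, w] h ∈ U)
          (h3 : ![x * z, y * z, w ^ 2] ≠ 0),
        Q ⟨Projectivization.mk ℂ ![x, y, z, w] h, hU⟩ =
          Projectivization.mk ℂ ![x * z, y * z, w ^ 2] h3) ∧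
      Continuous Q ∧ Function.Surjective Q ∧
      (∀ (p : P3) (hp : p ∈ U),
        Subtype.val '' (Q ⁻¹' {Q ⟨p, hp⟩}) = MulAction.orbit ℂˣ p) := by
  refine ⟨aux_inv, fun x y z w h hU => auxq_ne ((aux_mem_U _ h).1 hU), auxQ,
    fun x y z w h hU h3 => auxQ_mk _ h hU h3, aux_cont, aux_surj, fun p hp => ?_⟩
  ext p'
  have key : ∀ hp' : p' ∈ U, auxQ ⟨p', hp'⟩ = auxQ ⟨p, hp⟩ ↔ ∃ lam : ℂˣ, lam • p = p' := by
    induction p using Projectivization.ind with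
    | h v hv =>
      induction p' using Projectivization.ind with
      | h v' hv' => exact fun hp' => aux_fiber v v' hv hv' hp hp'
  constructor
  · rintro ⟨⟨r, hr⟩, hq, rfl⟩
    exact (key hr).1 hq
  · rintro ⟨lam, hl⟩
    have hp' : p' ∈ U := hl ▸ aux_inv p hp lam
    exact ⟨⟨p', hp'⟩, (key hp').2 ⟨lam, hl⟩, rfl⟩
end
end

section
/- Let B = {([u:v:s], [p:q]) ∈ ℙ²(ℂ) × ℙ¹(ℂ) : u·q = v·p} (the blowup of ℙ² at the point [0:0:1], realized as an incidence variety), and let V = {[x:y:z:w] ∈ ℙ³(ℂ) : (x,y) ≠ (0,0) and (z,w) ≠ (0,0)}. Then V is invariant under the ℂˣ-action λ·[x:y:z:w] = [λx : λy : λ⁻¹z : w], the formula Q'([x:y:z:w]) = ([xz : yz : w²], [x : y]) defines a well-defined continuous surjection Q' : V → B, and the fibers of Q' are precisely the ℂˣ-orbits contained in V. -/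
noncomputable section

open Projectivization
open scoped LinearAlgebra.Projectivization

/-- The blowup `B ⊆ ℙ² × ℙ¹` of `ℙ²` at `[0:0:1]`, as the incidence variety `u·q = v·p`. -/
def B : Set (P2 × P1) :=
  {b | ∃ (u v s : ℂ) (h : ![u, v, s] ≠ 0) (p q : ℂ) (h' : ![p, q] ≠ 0),
    b = (Projectivization.mk ℂ ![u, v, s] h, Projectivization.mk ℂ ![p, q] h') ∧
    u * q = v * p}

/-- The stable locus `V = {(x,y) ≠ 0 and (z,w) ≠ 0}` for the chamber `[0,1]`. -/
def V : Set P3 :=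
  {p | ∃ (x y z w : ℂ) (h : ![x, y, z, w] ≠ 0),
    p = Projectivization.mk ℂ ![x, y, z, w] h ∧ (x ≠ 0 ∨ y ≠ 0) ∧ (z ≠ 0 ∨ w ≠ 0)}

lemma vec4_eta (v : Fin 4 → ℂ) : v = ![v 0, v 1, v 2, v 3] := by
  funext i; fin_cases i <;> rfl

lemma mk_congr' {n : ℕ} {v w : Fin n → ℂ} (hv : v ≠ 0) (hw : w ≠ 0) (h : v = w) :
    Projectivization.mk ℂ v hv = Projectivization.mk ℂ w hw := by subst h; rfl

/-- The stability condition on representatives. -/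
def GV (v : Fin 4 → ℂ) : Prop := (v 0 ≠ 0 ∨ v 1 ≠ 0) ∧ (v 2 ≠ 0 ∨ v 3 ≠ 0)

lemma mem_V_iff (v : Fin 4 → ℂ) (hv : v ≠ 0) : Projectivization.mk ℂ v hv ∈ V ↔ GV v := by
  constructor
  · rintro ⟨x, y, z, w, h, he, h1, h2⟩
    obtain ⟨a, ha⟩ := (Projectivization.mk_eq_mk_iff' ℂ _ _ _ _).1 he
    have ha0 : a ≠ 0 := by
      rintro rfl; apply hv; rw [← ha, zero_smul]
    subst ha
    simpa [GV, ha0] using ⟨h1, h2⟩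
  · intro h
    exact ⟨v 0, v 1, v 2, v 3, (vec4_eta v) ▸ hv, mk_congr' _ _ (vec4_eta v), h.1, h.2⟩

lemma ne3 {v : Fin 4 → ℂ} (h : GV v) : ![v 0 * v 2, v 1 * v 2, v 3 ^ 2] ≠ 0 := by
  intro H
  have e0 := congrFun H 0
  have e1 := congrFun H 1
  have e2 := congrFun H 2
  simp at e0 e1 e2
  obtain ⟨h1, h2⟩ := h
  tauto

lemma ne2 {v : Fin 4 → ℂ} (h : GV v) : ![v 0, v 1] ≠ 0 := by
  intro H
  have e0 := congrFun H 0
  have e1 := congrFun H 1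
  simp at e0 e1
  obtain ⟨h1, h2⟩ := h
  tauto

/-- The map on representatives. -/
def q0 (v : Fin 4 → ℂ) (h : GV v) : B :=
  ⟨(Projectivization.mk ℂ ![v 0 * v 2, v 1 * v 2, v 3 ^ 2] (ne3 h),
    Projectivization.mk ℂ ![v 0, v 1] (ne2 h)),
    ⟨_, _, _, ne3 h, _, _, ne2 h, rfl, by ring⟩⟩

lemma GV_rep (p : V) : GV p.1.rep := by
  rw [← mem_V_iff _ p.1.rep_nonzero, Projectivization.mk_rep]; exact p.2

/-- The quotient map. -/
def QQ (p : V) : B := q0 p.1.rep (GV_rep p)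

lemma q0_eq_iff (v w : Fin 4 → ℂ) (hv : GV v) (hw : GV w) :
    q0 v hv = q0 w hw ↔
      (∃ a : ℂ, a * (w 0 * w 2) = v 0 * v 2 ∧ a * (w 1 * w 2) = v 1 * v 2 ∧
        a * w 3 ^ 2 = v 3 ^ 2) ∧ ∃ b : ℂ, b * w 0 = v 0 ∧ b * w 1 = v 1 := by
  rw [Subtype.ext_iff]
  change (_, _) = (_, _) ↔ _
  rw [Prod.mk.injEq, Projectivization.mk_eq_mk_iff',
    Projectivization.mk_eq_mk_iff']
  simp

lemma QQ_mk (v : Fin 4 → ℂ) (hv : v ≠ 0) (h : Projectivization.mk ℂ v hv ∈ V) :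
    QQ ⟨Projectivization.mk ℂ v hv, h⟩ = q0 v ((mem_V_iff v hv).1 h) := by
  unfold QQ
  obtain ⟨a, ha⟩ := Projectivization.exists_smul_eq_mk_rep ℂ v hv
  rw [q0_eq_iff]
  simp only [← ha]
  refine ⟨⟨(a : ℂ) ^ 2, ?_, ?_, ?_⟩, (a : ℂ), ?_, ?_⟩ <;>
    simp [Units.smul_def] <;> ring

lemma smul_mk_eq_iff (v w : Fin 4 → ℂ) (hv : v ≠ 0) (hw : w ≠ 0) (lam : ℂˣ) :
    lam • Projectivization.mk ℂ w hw = Projectivization.mk ℂ v hv ↔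
      ∃ a : ℂ, a * v 0 = lam * w 0 ∧ a * v 1 = lam * w 1 ∧
        a * v 2 = (lam : ℂ)⁻¹ * w 2 ∧ a * v 3 = w 3 := by
  rw [smul_mk4, Projectivization.mk_eq_mk_iff']
  simp [funext_iff, Fin.forall_fin_succ, wt4]

lemma fiber_iff (v w : Fin 4 → ℂ) (hv : v ≠ 0) (hw : w ≠ 0) (gv : GV v) (gw : GV w) :
    q0 v gv = q0 w gw ↔
      ∃ lam : ℂˣ, lam • Projectivization.mk ℂ w hw = Projectivization.mk ℂ v hv := by
  simp only [smul_mk_eq_iff]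
  rw [q0_eq_iff]
  constructor
  · rintro ⟨⟨a, a0, a1, a2⟩, b, b0, b1⟩
    have hb : b ≠ 0 := by
      rintro rfl
      have := gv.1
      simp at b0 b1
      rcases this with h | h
      · exact h b0.symm
      · exact h b1.symm
    have ha : a ≠ 0 := by
      rintro rfl
      apply ne3 gv
      rw [zero_mul] at a0 a1 a2
      rw [← a0, ← a1, ← a2]
      simp
    -- `b * v 2 = a * w 2`
    have h2 : b * v 2 = a * w 2 := by
      rcases gw.1 with h | h
      · apply mul_left_cancel₀ h; rw [← b0] at a0; linear_combination -a0
      · apply mul_left_cancel₀ h; rw [← b1] at a1; linear_combination -a1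
    obtain ⟨e, he0, he2, he⟩ : ∃ e : ℂ, e ≠ 0 ∧ e ^ 2 = a ∧ e * w 3 = v 3 := by
      by_cases h3 : w 3 = 0
      · obtain ⟨e, he⟩ := IsAlgClosed.exists_pow_nat_eq a (n := 2) (by norm_num)
        refine ⟨e, ?_, he, ?_⟩
        · rintro rfl; apply ha; rw [← he]; norm_num
        · rw [h3] at a2 ⊢
          have : v 3 = 0 := by
            rw [← sq_eq_zero_iff, ← a2]; ring
          rw [this, mul_zero]
      · have : (v 3 / w 3) ^ 2 = a := by
          rw [div_pow, ← a2]; field_simp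
        refine ⟨v 3 / w 3, ?_, this, by field_simp⟩
        intro h; rw [h] at this; apply ha; rw [← this]; norm_num
    refine ⟨Units.mk0 (b / e) (div_ne_zero hb he0), e⁻¹, ?_, ?_, ?_, ?_⟩
    · rw [← b0, Units.val_mk0]; field_simp
    · rw [← b1, Units.val_mk0]; field_simp
    · rw [Units.val_mk0]; field_simp; rw [he2, ← h2]; ring
    · rw [← he]; field_simp
  · rintro ⟨lam, a, h0, h1, h2, h3⟩
    have hl : (lam : ℂ) ≠ 0 := lam.ne_zero
    have ha : a ≠ 0 := by
      rintro rfl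
      rcases gw.1 with h | h
      · simp at h0; exact h h0
      · simp at h1; exact h h1
    have h2' : w 2 = lam * (a * v 2) := by rw [h2]; field_simp
    have h0' : w 0 = a * v 0 / lam := by rw [h0]; field_simp
    have h1' : w 1 = a * v 1 / lam := by rw [h1]; field_simp
    rw [h0', h1', h2', ← h3]
    refine ⟨⟨(a ^ 2)⁻¹, ?_, ?_, ?_⟩, lam / a, ?_, ?_⟩ <;> field_simp

lemma V_open : IsOpen V := by
  rw [← (pr_quot 4).isOpen_preimage]
  have : pr 4 ⁻¹' V = {v | GV v.1} := by
    ext v; exact mem_V_iff v.1 v.2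
  rw [this]
  have c : ∀ i : Fin 4, IsOpen {v : {v : Fin 4 → ℂ // v ≠ 0} | v.1 i ≠ 0} := fun i =>
    isOpen_ne_fun ((continuous_apply i).comp continuous_subtype_val) continuous_const
  exact ((c 0).union (c 1)).inter ((c 2).union (c 3))

lemma QQ_cont : Continuous QQ := by
  rw [((pr_quot 4).restrictPreimage_isOpen V_open).continuous_iff]
  have hc : ∀ i : Fin 4, Continuous (fun v : (pr 4 ⁻¹' V) => v.1.1 i) := fun i =>
    (continuous_apply i).comp (continuous_subtype_val.comp continuous_subtype_val)
  have : QQ ∘ V.restrictPreimage (pr 4) =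
      fun v => q0 v.1.1 ((mem_V_iff v.1.1 v.1.2).1 v.2) := by
    funext v
    exact QQ_mk v.1.1 v.1.2 v.2
  rw [this]
  refine Continuous.subtype_mk (Continuous.prodMk ?_ ?_) _
  · refine (pr_quot 3).continuous.comp
      (Continuous.subtype_mk (f := fun v : (pr 4 ⁻¹' V) =>
        ![v.1.1 0 * v.1.1 2, v.1.1 1 * v.1.1 2, v.1.1 3 ^ 2]) ?_
        (fun v => ne3 ((mem_V_iff v.1.1 v.1.2).1 v.2)))
    refine continuous_pi fun i => ?_
    fin_cases i
    · exact (hc 0).mul (hc 2)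
    · exact (hc 1).mul (hc 2)
    · exact (hc 3).pow 2
  · refine (pr_quot 2).continuous.comp
      (Continuous.subtype_mk (f := fun v : (pr 4 ⁻¹' V) => ![v.1.1 0, v.1.1 1]) ?_
        (fun v => ne2 ((mem_V_iff v.1.1 v.1.2).1 v.2)))
    refine continuous_pi fun i => ?_
    fin_cases i
    · exact hc 0
    · exact hc 1

lemma QQ_surj : Function.Surjective QQ := by
  rintro ⟨b, u, v, s, h, p, q, h', rfl, e⟩
  have hpq : p ≠ 0 ∨ q ≠ 0 := by
    by_contra! H
    apply h'; rw [H.1, H.2]; simp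
  obtain ⟨t, hu, hv⟩ : ∃ t : ℂ, p * t = u ∧ q * t = v := by
    by_cases hp : p = 0
    · have hq : q ≠ 0 := by tauto
      refine ⟨v / q, ?_, by field_simp⟩
      apply mul_right_cancel₀ hq; rw [e]; field_simp
    · refine ⟨u / p, by field_simp, ?_⟩
      apply mul_right_cancel₀ hp; rw [← e]; field_simp
  obtain ⟨w, hw⟩ := IsAlgClosed.exists_pow_nat_eq s (n := 2) (by norm_num)
  have g : GV ![p, q, t, w] := by
    refine ⟨hpq, ?_⟩
    by_contra! H
    have e1 : t = 0 := H.1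
    have e2 : w = 0 := H.2
    apply h
    rw [← hu, ← hv, ← hw, e1, e2]; simp
  have hne : ![p, q, t, w] ≠ 0 := by
    rcases g.1 with h | h
    · exact ne_zero_of_coord 0 h
    · exact ne_zero_of_coord 1 h
  refine ⟨⟨Projectivization.mk ℂ _ hne, (mem_V_iff _ hne).2 g⟩, ?_⟩
  rw [QQ_mk]
  apply Subtype.ext
  refine Prod.ext (mk_congr' _ _ ?_) rfl
  rw [← hu, ← hv, ← hw]; rfl

lemma V_inv (p : P3) (hp : p ∈ V) (lam : ℂˣ) : lam • p ∈ V := by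
  induction p using Projectivization.ind with
  | h v hv =>
    rw [mem_V_iff] at hp
    rw [smul_mk4, mem_V_iff]
    simpa only [GV, ne_eq, mul_eq_zero, wt4_ne, false_or] using hp

/-- `V` is `ℂˣ`-invariant, and `Q'([x:y:z:w]) = ([xz : yz : w²], [x : y])` gives a well-defined
continuous surjection `Q' : V → B` whose fibers are precisely the `ℂˣ`-orbits contained in
`V`. -/
theorem geometric_quotient_blowup :
    (∀ p ∈ V, ∀ lam : ℂˣ, lam • p ∈ V) ∧
    ∃ Q' : V → B,
      (∀ (x y z w : ℂ) (h : ![x, y, z, w] ≠ 0)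
          (hV : Projectivization.mk ℂ ![x, y, z, w] h ∈ V)
          (h1 : ![x * z, y * z, w ^ 2] ≠ 0) (h2 : ![x, y] ≠ 0),
        (Q' ⟨Projectivization.mk ℂ ![x, y, z, w] h, hV⟩ : P2 × P1) =
          (Projectivization.mk ℂ ![x * z, y * z, w ^ 2] h1,
           Projectivization.mk ℂ ![x, y] h2)) ∧
      Continuous Q' ∧ Function.Surjective Q' ∧
      (∀ (p : P3) (hp : p ∈ V),
        Subtype.val '' (Q' ⁻¹' {Q' ⟨p, hp⟩}) = MulAction.orbit ℂˣ p) := by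
  refine ⟨V_inv, QQ, ?_, QQ_cont, QQ_surj, ?_⟩
  · intro x y z w h hV h1 h2
    rw [QQ_mk]; rfl
  · intro p hp
    induction p using Projectivization.ind with
    | h w hw =>
      ext r
      induction r using Projectivization.ind with
      | h v hv =>
        have key := fun gv => fiber_iff v w hv hw gv ((mem_V_iff w hw).1 hp)
        constructor
        · rintro ⟨⟨r, hr⟩, h1, h2⟩
          have h2 : r = Projectivization.mk ℂ v hv := h2
          subst h2
          have h1 : QQ _ = QQ _ := h1
          rw [QQ_mk, QQ_mk] at h1
          exact (key _).1 h1
        · rintro ⟨lam, hl⟩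
          have hl : lam • Projectivization.mk ℂ w hw = Projectivization.mk ℂ v hv := hl
          have hr : Projectivization.mk ℂ v hv ∈ V := hl ▸ V_inv _ hp lam
          refine ⟨⟨_, hr⟩, ?_, rfl⟩
          change QQ _ = QQ _
          rw [QQ_mk, QQ_mk]
          exact (key _).2 ⟨lam, hl⟩
end
end
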